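/- Let H be a real separable Hilbert space and let μ be a positive Borel measure on H with ∫ (1 + ‖x‖²) dμ(x) < ∞. Let T : L²(H, μ; ℝ) → H be the continuous linear operator determined by ⟨T(u), v⟩_H = ∫ u(x) ⟨x, v⟩_H dμ(x) for all u ∈ L²(H, μ; ℝ) and v ∈ H. Then T is a compact operator: it is a limit in operator norm of finite-rank operators, equivalently the image under T of the closed unit ball of L²(H, μ; ℝ) is relatively compact in H. -/

import Mathlib

open MeasureTheory RealInnerProductSpace

/-- Integration against an indicator function with a constant vector value is a rank-one
operator. -/
lemma lpPairing_lsmul_flip_indicatorConstLp {α E : Type*} [MeasurableSpace α] {μ : Measure α}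
    [NormedAddCommGroup E] [NormedSpace ℝ E] [CompleteSpace E] {s : Set α}
    (hs : MeasurableSet s) (hμs : μ s ≠ ⊤) (c : E) (u : Lp ℝ 2 μ) :
    (ContinuousLinearMap.lsmul ℝ ℝ (E := E)).flip.lpPairing μ 2 2
        (indicatorConstLp 2 hs hμs c) u =
      (ContinuousLinearMap.mul ℝ ℝ).lpPairing μ 2 2 (indicatorConstLp 2 hs hμs 1) u • c := by
  rw [ContinuousLinearMap.lpPairing_eq_integral, ContinuousLinearMap.lpPairing_eq_integral,
    ← integral_smul_const]
  refine integral_congr_ae ?_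
  filter_upwards [indicatorConstLp_coeFn (p := 2) (hs := hs) (hμs := hμs) (c := c),
    indicatorConstLp_coeFn (p := 2) (hs := hs) (hμs := hμs) (c := (1 : ℝ))] with x hc h1
  by_cases hx : x ∈ s <;> simp [hc, h1, hx]

/-- For `f` in `L²(μ; E)`, the operator `u ↦ ∫ u(x) • f(x) dμ(x)` on `L²(μ; ℝ)` is compact. -/
theorem isCompactOperator_lpPairing_lsmul_flip {α E : Type*} [MeasurableSpace α]
    {μ : Measure α} [NormedAddCommGroup E] [NormedSpace ℝ E] [CompleteSpace E]
    (f : Lp E 2 μ) :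
    IsCompactOperator ((ContinuousLinearMap.lsmul ℝ ℝ (E := E)).flip.lpPairing μ 2 2 f) := by
  induction f using Lp.induction (p := 2) ENNReal.ofNat_ne_top with
  | indicatorConst c hs hμs =>
    rw [Lp.simpleFunc.coe_indicatorConst]
    have hrank : (ContinuousLinearMap.lsmul ℝ ℝ (E := E)).flip.lpPairing μ 2 2
        (indicatorConstLp 2 hs hμs.ne c) = (ContinuousLinearMap.toSpanSingleton ℝ c).comp
          ((ContinuousLinearMap.mul ℝ ℝ).lpPairing μ 2 2 (indicatorConstLp 2 hs hμs.ne 1)) :=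
      ContinuousLinearMap.ext (lpPairing_lsmul_flip_indicatorConstLp hs hμs.ne c)
    rw [hrank]
    exact (isCompactOperator_of_locallyCompactSpace_dom _).clm_comp
      (ContinuousLinearMap.toSpanSingleton ℝ c)
  | add hf hg _ hPf hPg =>
    rw [map_add]
    exact hPf.add hPg
  | isClosed =>
    exact isClosed_setOfPred_isCompactOperator.preimage (ContinuousLinearMap.continuous _)

/-- Let `H` be a real separable Hilbert space and `μ` a
positive Borel measure on `H` with `∫ (1 + ‖x‖²) dμ < ∞`. The continuous
linear operator `T : L²(H, μ; ℝ) → H` determined by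
`⟪T u, v⟫ = ∫ u(x) ⟪x, v⟫ dμ(x)` is a compact operator. -/
theorem secondMoment_operator_isCompact
    {H : Type*} [NormedAddCommGroup H] [InnerProductSpace ℝ H]
    [CompleteSpace H] [TopologicalSpace.SeparableSpace H]
    [MeasurableSpace H] [BorelSpace H]
    (μ : Measure H) (hμ : Integrable (fun x => 1 + ‖x‖ ^ 2) μ)
    (T : Lp ℝ 2 μ →L[ℝ] H)
    (hT : ∀ (u : Lp ℝ 2 μ) (v : H), ⟪T u, v⟫ = ∫ x, u x * ⟪x, v⟫ ∂μ) :
    IsCompactOperator T := by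
  have : SecondCountableTopology H := UniformSpace.secondCountable_of_separable H
  have hmeas : AEStronglyMeasurable (fun x : H => x) μ := aestronglyMeasurable_id
  have hid : MemLp (fun x : H => x) 2 μ := by
    refine (memLp_two_iff_integrable_sq_norm hmeas).2 (hμ.mono' (by fun_prop) ?_)
    refine .of_forall fun x => ?_
    rw [Real.norm_of_nonneg (by positivity)]
    linarith
  convert isCompactOperator_lpPairing_lsmul_flip (hid.toLp _) using 1
  ext1 u
  refine ext_inner_right ℝ fun v => ?_
  have hint : Integrable (fun x => u x • x) μ :=
    memLp_one_iff_integrable.1 (hid.smul (Lp.memLp u))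
  have hpair : (ContinuousLinearMap.lsmul ℝ ℝ (E := H)).flip.lpPairing μ 2 2 (hid.toLp _) u =
      ∫ x, u x • x ∂μ := by
    rw [ContinuousLinearMap.lpPairing_eq_integral]
    refine integral_congr_ae ?_
    filter_upwards [hid.coeFn_toLp] with x hx
    simp [hx]
  rw [hT, hpair, real_inner_comm, ← integral_inner hint]
  simp [real_inner_smul_right, real_inner_comm]
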